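/- arXiv:1908.06529 — 4 statements merged into one kernel-verified Lean document; each statement's English description precedes it below -/
import Mathlib

section
/- Let 1 ≤ p < ∞ and let φ : [0,∞) → ℝ be a Lipschitz function with φ(0) = 0. Define the Kalton–Peck map Ω^φ_p : c00 → c00 by Ω^φ_p(x)(n) = x(n)·φ((p/2)·log(‖x‖_p/|x(n)|)) if x(n) ≠ 0 and Ω^φ_p(x)(n) = 0 otherwise. Then there exist constants C and Q, depending only on p and the Lipschitz constant of φ, such that for every bounded sequence a : ℕ → ℝ and all x, y ∈ c00 one has (i) ‖Ω^φ_p(a·x) − a·Ω^φ_p(x)‖_p ≤ C‖a‖_∞‖x‖_p (the centralizer estimate), and (ii) ‖Ω^φ_p(x+y) − Ω^φ_p(x) − Ω^φ_p(y)‖_p ≤ Q(‖x‖_p + ‖y‖_p) (quasilinearity). -/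
/-- `x : ℕ → ℝ` is finitely supported (i.e. belongs to `c00`). -/
def FinSupp (x : ℕ → ℝ) : Prop := (Function.support x).Finite

/-- The `ℓ_p` norm of a sequence, `‖x‖_p = (∑ₙ |x n|^p)^(1/p)`. -/
noncomputable def pNorm (p : ℝ) (x : ℕ → ℝ) : ℝ := (∑' n, |x n| ^ p) ^ (1 / p)

/-- The Kalton–Peck map `Ω^φ_p` on `c00`:
`Ω^φ_p(x)(n) = x n · φ((p/2)·log(‖x‖_p/|x n|))` when `x n ≠ 0`, and `0` otherwise. -/
noncomputable def KP (p : ℝ) (φ : ℝ → ℝ) (x : ℕ → ℝ) : ℕ → ℝ :=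
  fun n => if x n = 0 then 0 else x n * φ (p / 2 * Real.log (pNorm p x / |x n|))

theorem FinSupp.summable {p : ℝ} (hp : 0 < p) {x : ℕ → ℝ} (hx : FinSupp x) :
    Summable fun n => |x n| ^ p := by
  refine summable_of_hasFiniteSupport (hx.subset fun n hn => ?_)
  contrapose! hn
  simp_all [Real.zero_rpow hp.ne']

theorem FinSupp.add {x y : ℕ → ℝ} (hx : FinSupp x) (hy : FinSupp y) : FinSupp (x + y) :=
  (hx.union hy).subset (Function.support_add x y)

theorem FinSupp.mul_left {x : ℕ → ℝ} (hx : FinSupp x) (a : ℕ → ℝ) :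
    FinSupp fun n => a n * x n :=
  hx.subset fun _ hn => right_ne_zero_of_mul hn

theorem FinSupp.abs {x : ℕ → ℝ} (hx : FinSupp x) : FinSupp fun n => |x n| :=
  hx.subset fun _ hn => abs_ne_zero.1 hn

theorem pNorm_nonneg (p : ℝ) (x : ℕ → ℝ) : 0 ≤ pNorm p x :=
  Real.rpow_nonneg (tsum_nonneg fun _ => Real.rpow_nonneg (abs_nonneg _) _) _

theorem pNorm_mono {p : ℝ} (hp : 0 < p) {x y : ℕ → ℝ} (hy : FinSupp y)
    (h : ∀ n, |x n| ≤ |y n|) : pNorm p x ≤ pNorm p y := by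
  have hxy : ∀ n, |x n| ^ p ≤ |y n| ^ p := fun n =>
    Real.rpow_le_rpow (abs_nonneg _) (h n) hp.le
  have hs := hy.summable hp
  refine Real.rpow_le_rpow (tsum_nonneg fun _ => Real.rpow_nonneg (abs_nonneg _) _)
    (Summable.tsum_le_tsum hxy ?_ hs) (by positivity)
  exact Summable.of_nonneg_of_le (fun n => Real.rpow_nonneg (abs_nonneg _) _) hxy hs

theorem pNorm_abs (p : ℝ) (x : ℕ → ℝ) : pNorm p (fun n => |x n|) = pNorm p x := by
  simp [pNorm]

theorem pNorm_const_mul {p : ℝ} (hp : 0 < p) {c : ℝ} (hc : 0 ≤ c) (x : ℕ → ℝ) :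
    pNorm p (fun n => c * x n) = c * pNorm p x := by
  have h : ∀ n, |c * x n| ^ p = c ^ p * |x n| ^ p := fun n => by
    rw [abs_mul, abs_of_nonneg hc, Real.mul_rpow hc (abs_nonneg _)]
  simp only [pNorm, h, tsum_mul_left]
  rw [Real.mul_rpow (Real.rpow_nonneg hc _)
    (tsum_nonneg fun _ => Real.rpow_nonneg (abs_nonneg _) _), ← Real.rpow_mul hc,
    mul_one_div_cancel hp.ne', Real.rpow_one]

theorem pNorm_add_le {p : ℝ} (hp : 1 ≤ p) {x y : ℕ → ℝ} (hx : FinSupp x) (hy : FinSupp y) :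
    pNorm p (x + y) ≤ pNorm p x + pNorm p y := by
  have hp0 : 0 < p := by linarith
  have h := Real.Lp_add_le_tsum_of_nonneg hp (fun n => abs_nonneg (x n))
    (fun n => abs_nonneg (y n)) (hx.summable hp0) (hy.summable hp0)
  calc pNorm p (x + y) ≤ pNorm p (fun n => |x n| + |y n|) :=
        pNorm_mono hp0 (hx.abs.add hy.abs) fun n => (abs_add_le _ _).trans (le_abs_self _)
    _ ≤ _ := by
        have e : ∀ n, |(|x n| + |y n|)| = |x n| + |y n| := fun n => abs_of_nonneg (by positivity)
        simpa only [pNorm, e] using h.2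

theorem abs_le_pNorm {p : ℝ} (hp : 0 < p) {x : ℕ → ℝ} (hx : FinSupp x) (n : ℕ) :
    |x n| ≤ pNorm p x := by
  have h : |x n| ^ p ≤ ∑' n, |x n| ^ p :=
    (hx.summable hp).le_tsum n fun _ _ => Real.rpow_nonneg (abs_nonneg _) _
  calc |x n| = (|x n| ^ p) ^ (1 / p) := by
        rw [← Real.rpow_mul (abs_nonneg _), mul_one_div_cancel hp.ne', Real.rpow_one]
    _ ≤ _ := Real.rpow_le_rpow (Real.rpow_nonneg (abs_nonneg _) _) h (by positivity)

theorem KP_apply (p : ℝ) (φ : ℝ → ℝ) (x : ℕ → ℝ) (n : ℕ) :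
    KP p φ x n = x n * φ (p / 2 * Real.log (pNorm p x / |x n|)) := by
  unfold KP
  split_ifs with h <;> simp [h]

theorem mul_log_div_le {s t : ℝ} (ht : 0 ≤ t) (hs : 0 ≤ s) : t * Real.log (s / t) ≤ s := by
  rcases ht.eq_or_lt with rfl | ht
  · simpa
  · calc t * Real.log (s / t) ≤ t * (s / t) :=
          mul_le_mul_of_nonneg_left (Real.log_le_self (by positivity)) ht.le
      _ = s := by field_simp

/-- The map `u ↦ φ (p / 2 * log u)` is Lipschitz on `[1, ∞)` in the logarithmic variable. -/
theorem abs_sub_le_log {p : ℝ} (hp : 0 < p) {L : NNReal} {φ : ℝ → ℝ}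
    (hφ : LipschitzOnWith L φ (Set.Ici 0)) {u v : ℝ} (hu : 1 ≤ u) (hv : 1 ≤ v) :
    |φ (p / 2 * Real.log u) - φ (p / 2 * Real.log v)|
      ≤ L * (p / 2) * |Real.log u - Real.log v| := by
  have hmem : ∀ {w : ℝ}, 1 ≤ w → p / 2 * Real.log w ∈ Set.Ici (0 : ℝ) := fun hw =>
    mul_nonneg (by positivity) (Real.log_nonneg hw)
  have h := hφ.dist_le_mul _ (hmem hu) _ (hmem hv)
  rwa [Real.dist_eq, Real.dist_eq, ← mul_sub, abs_mul, abs_of_pos (by positivity : 0 < p / 2),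
    ← mul_assoc] at h

/-- Replacing the scale `R` by a larger scale `S`. -/
theorem abs_mul_sub_scale_le {p : ℝ} (hp : 0 < p) {L : NNReal} {φ : ℝ → ℝ}
    (hφ : LipschitzOnWith L φ (Set.Ici 0)) {s R S : ℝ} (hs : |s| ≤ R) (hRS : R ≤ S) :
    |s * φ (p / 2 * Real.log (R / |s|)) - s * φ (p / 2 * Real.log (S / |s|))|
      ≤ L * (p / 2) * (S / R * |s|) := by
  rcases eq_or_ne s 0 with rfl | h0
  · simp
  have hs0 : 0 < |s| := abs_pos.2 h0
  have hR : 0 < R := hs0.trans_le hs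
  have hS : 0 < S := hR.trans_le hRS
  have h := abs_sub_le_log hp hφ ((one_le_div hs0).2 hs) ((one_le_div hs0).2 (hs.trans hRS))
  have hlog : |Real.log (R / |s|) - Real.log (S / |s|)| ≤ S / R := by
    have e : Real.log (R / |s|) - Real.log (S / |s|) = -Real.log (S / R) := by
      rw [Real.log_div hR.ne' hs0.ne', Real.log_div hS.ne' hs0.ne', Real.log_div hS.ne' hR.ne']
      ring
    rw [e, abs_neg, abs_of_nonneg (Real.log_nonneg ((one_le_div hR).2 hRS))]
    exact Real.log_le_self (by positivity)
  rw [← mul_sub, abs_mul]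
  calc |s| * _ ≤ |s| * (L * (p / 2) * (S / R)) :=
        mul_le_mul_of_nonneg_left (h.trans (mul_le_mul_of_nonneg_left hlog (by positivity)))
          hs0.le
    _ = _ := by ring

/-- Replacing the argument `|s|` inside the logarithm by a larger one. -/
theorem abs_mul_sub_arg_le {p : ℝ} (hp : 0 < p) {L : NNReal} {φ : ℝ → ℝ}
    (hφ : LipschitzOnWith L φ (Set.Ici 0)) {s r S : ℝ} (hs : |s| ≤ r) (hr : r ≤ S) :
    |s * φ (p / 2 * Real.log (S / |s|)) - s * φ (p / 2 * Real.log (S / r))|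
      ≤ L * (p / 2) * r := by
  rcases eq_or_ne s 0 with rfl | h0
  · have : 0 ≤ r := (abs_nonneg _).trans hs
    simp only [zero_mul, sub_zero, abs_zero]
    positivity
  have hs0 : 0 < |s| := abs_pos.2 h0
  have hr0 : 0 < r := hs0.trans_le hs
  have hS : 0 < S := hr0.trans_le hr
  have h := abs_sub_le_log hp hφ ((one_le_div hs0).2 (hs.trans hr)) ((one_le_div hr0).2 hr)
  have e : |Real.log (S / |s|) - Real.log (S / r)| = Real.log (r / |s|) := by
    rw [← abs_of_nonneg (Real.log_nonneg ((one_le_div hs0).2 hs)),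
      Real.log_div hS.ne' hs0.ne', Real.log_div hS.ne' hr0.ne', Real.log_div hr0.ne' hs0.ne']
    congr 1
    ring
  rw [e] at h
  rw [← mul_sub, abs_mul]
  calc |s| * _ ≤ |s| * (L * (p / 2) * Real.log (r / |s|)) :=
        mul_le_mul_of_nonneg_left h hs0.le
    _ = L * (p / 2) * (|s| * Real.log (r / |s|)) := by ring
    _ ≤ _ := mul_le_mul_of_nonneg_left (mul_log_div_le hs0.le hr0.le) (by positivity)

theorem KP_centralizer_pointwise {p : ℝ} (hp : 0 < p) {L : NNReal} {φ : ℝ → ℝ}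
    (hφ : LipschitzOnWith L φ (Set.Ici 0)) {a x : ℕ → ℝ} (hx : FinSupp x) {M : ℝ}
    (ha : ∀ n, |a n| ≤ M) (hA : pNorm p (fun m => a m * x m) ≤ M * pNorm p x) (n : ℕ) :
    |KP p φ (fun m => a m * x m) n - a n * KP p φ x n|
      ≤ L * (p / 2) * (M * pNorm p x / pNorm p (fun m => a m * x m) * |a n * x n|
          + M * |x n|) := by
  have hM : 0 ≤ M := (abs_nonneg _).trans (ha 0)
  have hN := pNorm_nonneg p x
  have hA0 := pNorm_nonneg p fun m => a m * x m
  rw [KP_apply, KP_apply]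
  have h1 := abs_mul_sub_scale_le hp hφ (abs_le_pNorm hp (hx.mul_left a) n) hA
  have hxn : M * |x n| ≤ M * pNorm p x :=
    mul_le_mul_of_nonneg_left (abs_le_pNorm hp hx n) hM
  have hax : |a n * x n| ≤ M * |x n| := by
    rw [abs_mul]
    exact mul_le_mul_of_nonneg_right (ha n) (abs_nonneg _)
  have h2 := abs_mul_sub_arg_le hp hφ hax hxn
  have e : a n * x n * φ (p / 2 * Real.log (M * pNorm p x / (M * |x n|)))
      = a n * (x n * φ (p / 2 * Real.log (pNorm p x / |x n|))) := by
    rcases hM.eq_or_lt with rfl | hM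
    · have : a n = 0 := abs_nonpos_iff.1 (ha n)
      simp [this]
    · rw [mul_div_mul_left _ _ hM.ne', mul_assoc]
  rw [e] at h2
  rw [mul_add]
  exact (abs_sub_le _ _ _).trans (add_le_add h1 h2)

theorem div_mul_self_le {c d : ℝ} (hc : 0 ≤ c) : c / d * d ≤ c := by
  rcases eq_or_ne d 0 with rfl | h
  · simpa
  · rw [div_mul_cancel₀ _ h]

theorem KP_centralizer {p : ℝ} (hp : 1 ≤ p) {L : NNReal} {φ : ℝ → ℝ}
    (hφ : LipschitzOnWith L φ (Set.Ici 0)) {a x : ℕ → ℝ} (hx : FinSupp x) {M : ℝ}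
    (ha : ∀ n, |a n| ≤ M) :
    pNorm p (fun n => KP p φ (fun m => a m * x m) n - a n * KP p φ x n)
      ≤ L * p * M * pNorm p x := by
  have hp0 : 0 < p := by linarith
  have hM : 0 ≤ M := (abs_nonneg _).trans (ha 0)
  have hN := pNorm_nonneg p x
  have hA0 := pNorm_nonneg p fun m => a m * x m
  have hA : pNorm p (fun m => a m * x m) ≤ M * pNorm p x := by
    rw [← pNorm_const_mul hp0 hM]
    refine pNorm_mono hp0 (hx.mul_left fun _ => M) fun n => ?_
    rw [abs_mul, abs_mul, abs_of_nonneg hM]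
    exact mul_le_mul_of_nonneg_right (ha n) (abs_nonneg _)
  have hpt := KP_centralizer_pointwise hp0 hφ hx ha hA
  set A := pNorm p fun m => a m * x m with hAdef
  set N := pNorm p x with hNdef
  have hc : 0 ≤ (L : ℝ) * (p / 2) := by positivity
  have hd : 0 ≤ M * N / A := by positivity
  have hu := (hx.mul_left a).abs.mul_left fun _ => M * N / A
  have hv := hx.abs.mul_left fun _ => M
  have huv := pNorm_add_le hp hu hv
  rw [pNorm_const_mul hp0 hd, pNorm_const_mul hp0 hM, pNorm_abs, pNorm_abs, ← hAdef,
    ← hNdef] at huv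
  calc _ ≤ pNorm p (fun n => L * (p / 2) *
          ((fun n => M * N / A * |a n * x n|) + fun n => M * |x n|) n) :=
        pNorm_mono hp0 ((hu.add hv).mul_left _) fun n => (hpt n).trans (le_abs_self _)
    _ = L * (p / 2) * pNorm p ((fun n => M * N / A * |a n * x n|) + fun n => M * |x n|) :=
        pNorm_const_mul hp0 hc _
    _ ≤ L * (p / 2) * (M * N + M * N) :=
        mul_le_mul_of_nonneg_left
          (huv.trans (add_le_add_left (div_mul_self_le (by positivity)) _)) hc
    _ = _ := by ring

theorem KP_apply_sub_le {p : ℝ} (hp : 0 < p) {L : NNReal} {φ : ℝ → ℝ}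
    (hφ : LipschitzOnWith L φ (Set.Ici 0)) {x : ℕ → ℝ} (hx : FinSupp x) {r S : ℝ} {n : ℕ}
    (hr : |x n| ≤ r) (hrS : r ≤ S) (hS : pNorm p x ≤ S) :
    |KP p φ x n - x n * φ (p / 2 * Real.log (S / r))|
      ≤ L * (p / 2) * (S / pNorm p x * |x n| + r) := by
  rw [KP_apply, mul_add]
  exact (abs_sub_le _ _ _).trans
    (add_le_add (abs_mul_sub_scale_le hp hφ (abs_le_pNorm hp hx n) hS)
      (abs_mul_sub_arg_le hp hφ hr hrS))

theorem pNorm_scaled_add_le {p : ℝ} (hp : 1 ≤ p) {x r : ℕ → ℝ} (hx : FinSupp x)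
    (hr : FinSupp r) {S : ℝ} (hS : 0 ≤ S) (hrS : pNorm p r ≤ S) :
    pNorm p ((fun n => S / pNorm p x * |x n|) + r) ≤ S + S := by
  refine (pNorm_add_le hp (hx.abs.mul_left fun _ => _) hr).trans (add_le_add ?_ hrS)
  rw [pNorm_const_mul (by linarith) (div_nonneg hS (pNorm_nonneg _ _)), pNorm_abs]
  exact div_mul_self_le hS

theorem KP_quasilinear {p : ℝ} (hp : 1 ≤ p) {L : NNReal} {φ : ℝ → ℝ}
    (hφ : LipschitzOnWith L φ (Set.Ici 0)) {x y : ℕ → ℝ} (hx : FinSupp x) (hy : FinSupp y) :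
    pNorm p (fun n => KP p φ (x + y) n - KP p φ x n - KP p φ y n)
      ≤ 3 * L * p * (pNorm p x + pNorm p y) := by
  have hp0 : 0 < p := by linarith
  have hX := pNorm_nonneg p x
  have hY := pNorm_nonneg p y
  have hxy := hx.add hy
  have hZ := pNorm_add_le hp hx hy
  set S := pNorm p x + pNorm p y with hSdef
  have hS : 0 ≤ S := add_nonneg hX hY
  have hc : 0 ≤ (L : ℝ) * (p / 2) := by positivity
  set r : ℕ → ℝ := (fun n => |x n|) + fun n => |y n| with hr
  have hrf : FinSupp r := hx.abs.add hy.abs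
  have hrn : pNorm p r ≤ S := by
    simpa only [pNorm_abs] using pNorm_add_le hp hx.abs hy.abs
  have hrS : ∀ n, r n ≤ S := fun n =>
    add_le_add (abs_le_pNorm hp0 hx n) (abs_le_pNorm hp0 hy n)
  let w : (ℕ → ℝ) → ℕ → ℝ := fun z => (fun n => S / pNorm p z * |z n|) + r
  have hw : ∀ {z}, FinSupp z → FinSupp (w z) := fun hz => (hz.abs.mul_left fun _ => _).add hrf
  have hwn : ∀ {z}, FinSupp z → pNorm p (w z) ≤ S + S := fun hz =>
    pNorm_scaled_add_le hp hz hrf hS hrn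
  have hpt : ∀ n, |KP p φ (x + y) n - KP p φ x n - KP p φ y n|
      ≤ L * (p / 2) * (w (x + y) + w x + w y) n := fun n => by
    have h1 := KP_apply_sub_le hp0 hφ hxy (abs_add_le (x n) (y n)) (hrS n) hZ
    have h2 := KP_apply_sub_le hp0 hφ hx (le_add_of_nonneg_right (abs_nonneg (y n))) (hrS n)
      (le_add_of_nonneg_right hY)
    have h3 := KP_apply_sub_le hp0 hφ hy (le_add_of_nonneg_left (abs_nonneg (x n))) (hrS n)
      (le_add_of_nonneg_left hX)
    simp only [Pi.add_apply, w, hr] at h1 h2 h3 ⊢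
    rw [abs_le] at h1 h2 h3 ⊢
    constructor <;> linarith [h1.1, h1.2, h2.1, h2.2, h3.1, h3.2]
  calc _ ≤ pNorm p (fun n => L * (p / 2) * (w (x + y) + w x + w y) n) :=
        pNorm_mono hp0 ((((hw hxy).add (hw hx)).add (hw hy)).mul_left _)
          fun n => (hpt n).trans (le_abs_self _)
    _ = L * (p / 2) * pNorm p (w (x + y) + w x + w y) := pNorm_const_mul hp0 hc _
    _ ≤ L * (p / 2) * ((S + S) + (S + S) + (S + S)) := by
        refine mul_le_mul_of_nonneg_left ?_ hc
        have h1 := pNorm_add_le hp ((hw hxy).add (hw hx)) (hw hy)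
        have h2 := pNorm_add_le hp (hw hxy) (hw hx)
        linarith [hwn hxy, hwn hx, hwn hy]
    _ = _ := by ring

/-- For `1 ≤ p < ∞` and `φ : [0,∞) → ℝ` Lipschitz (constant `L`) with
`φ 0 = 0`, there are constants `C` and `Q` depending only on `p` and `L` such that the
Kalton–Peck map `Ω^φ_p` satisfies the centralizer estimate
`‖Ω^φ_p(a·x) − a·Ω^φ_p(x)‖_p ≤ C‖a‖_∞‖x‖_p` for every bounded sequence `a` and `x ∈ c00`,
and the quasilinearity estimate
`‖Ω^φ_p(x+y) − Ω^φ_p(x) − Ω^φ_p(y)‖_p ≤ Q(‖x‖_p + ‖y‖_p)` for all `x, y ∈ c00`. -/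
theorem kaltonPeck_centralizer_and_quasilinear (p : ℝ) (hp : 1 ≤ p) (L : NNReal) :
    ∃ C Q : ℝ,
      ∀ φ : ℝ → ℝ, LipschitzOnWith L φ (Set.Ici 0) → φ 0 = 0 →
        ((∀ (a x : ℕ → ℝ), FinSupp x → ∀ M : ℝ, (∀ n, |a n| ≤ M) →
            pNorm p (fun n => KP p φ (fun m => a m * x m) n - a n * KP p φ x n)
              ≤ C * M * pNorm p x)
         ∧
         (∀ x y : ℕ → ℝ, FinSupp x → FinSupp y →
            pNorm p (fun n => KP p φ (x + y) n - KP p φ x n - KP p φ y n)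
              ≤ Q * (pNorm p x + pNorm p y))) := by
  exact ⟨L * p, 3 * L * p, fun φ hφ _ =>
    ⟨fun a x hx M ha => KP_centralizer hp hφ hx ha, fun x y hx hy => KP_quasilinear hp hφ hx hy⟩⟩
end

section
/- Let 1 ≤ p < ∞, let φ : [0,∞) → ℝ be a Lipschitz function with φ(0) = 0, and let (A_i)_{i∈ℕ} be a partition of ℕ. For x ∈ c00 write x_i = x·1_{A_i}, and define the chunked Kalton–Peck map Ω̃^φ_p : c00 → c00 by Ω̃^φ_p(x) = Σ_i x_i·φ((p/2)·log(‖x‖_p/‖x_i‖_p)), the sum extending over those i with x_i ≠ 0. Then there exists a constant C, depending only on p and the Lipschitz constant of φ, such that for every bounded sequence a : ℕ → ℝ and every x ∈ c00 one has ‖Ω̃^φ_p(a·x) − a·Ω̃^φ_p(x)‖_p ≤ C‖a‖_∞‖x‖_p. -/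
/-- A partition `(A_i)_{i∈ℕ}` of `ℕ` is encoded by the function `π : ℕ → ℕ` sending each
`n ∈ ℕ` to the index of the member of the partition containing it, so `A_i = π⁻¹(i)`.
`chunk π i x` is the corresponding chunk `x_i = x·1_{A_i}` of a sequence `x`. -/
noncomputable def chunk (π : ℕ → ℕ) (i : ℕ) (x : ℕ → ℝ) : ℕ → ℝ :=
  fun m => if π m = i then x m else 0

/-- The chunked Kalton–Peck map `Ω̃^φ_p` associated to the partition encoded by `π`:
`Ω̃^φ_p(x) = Σ_i x_i·φ((p/2)·log(‖x‖_p/‖x_i‖_p))`, the sum over those `i` with `x_i ≠ 0`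
(written pointwise: its value at `n` is `x n · φ((p/2)·log(‖x‖_p/‖x_{π n}‖_p))` when
`x n ≠ 0`, and `0` otherwise). -/
noncomputable def KPchunk (p : ℝ) (φ : ℝ → ℝ) (π : ℕ → ℕ) (x : ℕ → ℝ) : ℕ → ℝ :=
  fun n => if x n = 0 then 0
    else x n * φ (p / 2 * Real.log (pNorm p x / pNorm p (chunk π (π n) x)))

/-- If `t ≤ B * s`, then `t * |log (t / (B * s))| ^ p` is controlled by `B * s`. -/
lemma mul_abs_log_rpow_le {p B s t : ℝ} (hp : 0 < p) (ht : 0 ≤ t) (hts : t ≤ B * s) :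
    t * |Real.log (t / (B * s))| ^ p ≤ p ^ p * (B * s) := by
  rcases ht.eq_or_lt with rfl | ht
  · simpa using mul_nonneg (Real.rpow_nonneg hp.le p) hts
  have hs : 0 < B * s := ht.trans_le hts
  set u := t / (B * s) with hu
  have hu0 : 0 < u := div_pos ht hs
  have hu1 : u ≤ 1 := (div_le_one hs).2 hts
  have h := (Real.abs_log_mul_self_rpow_lt u (1 / p) hu0 hu1 (by positivity)).le
  rw [one_div_one_div, abs_mul, abs_of_nonneg (Real.rpow_nonneg hu0.le _)] at h
  have h2 := Real.rpow_le_rpow (by positivity) h hp.le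
  rw [Real.mul_rpow (abs_nonneg _) (by positivity), ← Real.rpow_mul hu0.le,
    one_div_mul_cancel hp.ne', Real.rpow_one] at h2
  have ht' : t = u * (B * s) := by rw [hu, div_mul_cancel₀ _ hs.ne']
  calc t * |Real.log u| ^ p = |Real.log u| ^ p * u * (B * s) := by rw [ht']; ring
    _ ≤ p ^ p * (B * s) := by gcongr

open Finset in
/-- The entropy-type estimate summed over the fibres of a map `π`. -/
lemma sum_mul_abs_log_fiber_rpow_le {p B : ℝ} (hp : 0 < p) (F : Finset ℕ) (π : ℕ → ℕ)
    {v w : ℕ → ℝ} (hv : ∀ n, 0 ≤ v n) (hvw : ∀ n, v n ≤ B * w n) :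
    ∑ n ∈ F, v n * |Real.log ((∑ m ∈ F with π m = π n, v m) /
        (B * ∑ m ∈ F with π m = π n, w m))| ^ p ≤ p ^ p * (B * ∑ n ∈ F, w n) := by
  have hmaps : ∀ n ∈ F, π n ∈ F.image π := fun n hn => mem_image_of_mem π hn
  rw [← sum_fiberwise_of_maps_to hmaps w, mul_sum, mul_sum, ← sum_fiberwise_of_maps_to hmaps]
  refine sum_le_sum fun i _ => ?_
  have hi : ∑ n ∈ F with π n = i, v n * |Real.log ((∑ m ∈ F with π m = π n, v m) /
      (B * ∑ m ∈ F with π m = π n, w m))| ^ p = (∑ n ∈ F with π n = i, v n) *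
        |Real.log ((∑ m ∈ F with π m = i, v m) / (B * ∑ m ∈ F with π m = i, w m))| ^ p := by
    rw [sum_mul]
    refine sum_congr rfl fun n hn => ?_
    rw [(mem_filter.1 hn).2]
  rw [hi]
  refine mul_abs_log_rpow_le hp (sum_nonneg fun n _ => hv n) ?_
  rw [mul_sum]
  exact sum_le_sum fun n _ => hvw n

lemma pNorm_eq_sum {p : ℝ} (hp : 0 < p) (F : Finset ℕ) {y : ℕ → ℝ} (hy : ∀ n ∉ F, y n = 0) :
    pNorm p y = (∑ n ∈ F, |y n| ^ p) ^ (1 / p) := by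
  rw [pNorm, tsum_eq_sum fun n hn => by rw [hy n hn, abs_zero, Real.zero_rpow hp.ne']]

open Finset in
lemma pNorm_chunk_eq_sum {p : ℝ} (hp : 0 < p) (F : Finset ℕ) {y : ℕ → ℝ}
    (hy : ∀ n ∉ F, y n = 0) (π : ℕ → ℕ) (i : ℕ) :
    pNorm p (chunk π i y) = (∑ n ∈ F with π n = i, |y n| ^ p) ^ (1 / p) := by
  rw [pNorm_eq_sum hp F (fun n hn => by simp [chunk, hy n hn]), sum_filter]
  congr 1
  refine sum_congr rfl fun n _ => ?_
  by_cases h : π n = i <;> simp [chunk, h, Real.zero_rpow hp.ne']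

open Finset in
/-- The value of the chunked Kalton–Peck map at a point of the support, together with the
positivity and monotonicity facts about the sums that enter it. -/
lemma KPchunk_apply_of_ne_zero {p : ℝ} (hp : 0 < p) (φ : ℝ → ℝ) (π : ℕ → ℕ) (F : Finset ℕ)
    {y : ℕ → ℝ} (hy : ∀ n ∉ F, y n = 0) {n : ℕ} (hn : y n ≠ 0) :
    0 < ∑ m ∈ F with π m = π n, |y m| ^ p ∧
    ∑ m ∈ F with π m = π n, |y m| ^ p ≤ ∑ m ∈ F, |y m| ^ p ∧
    KPchunk p φ π y n = y n * φ ((Real.log (∑ m ∈ F, |y m| ^ p) -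
      Real.log (∑ m ∈ F with π m = π n, |y m| ^ p)) / 2) := by
  have hnF : n ∈ F := by_contra fun h => hn (hy n h)
  have hpos : 0 < ∑ m ∈ F with π m = π n, |y m| ^ p :=
    sum_pos' (fun m _ => by positivity) ⟨n, by simp [hnF], by positivity⟩
  have hle : ∑ m ∈ F with π m = π n, |y m| ^ p ≤ ∑ m ∈ F, |y m| ^ p :=
    sum_le_sum_of_subset_of_nonneg (filter_subset _ _) fun m _ _ => by positivity
  refine ⟨hpos, hle, ?_⟩
  have hpos' := hpos.trans_le hle
  rw [KPchunk, if_neg hn, pNorm_eq_sum hp F hy, pNorm_chunk_eq_sum hp F hy,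
    Real.log_div (by positivity) (by positivity), Real.log_rpow hpos', Real.log_rpow hpos]
  congr 2
  field_simp

open Finset in
/-- Pointwise bound for the centralizer defect of the chunked Kalton–Peck map. -/
lemma abs_KPchunk_mul_sub_le {p : ℝ} (hp : 0 < p) {L : NNReal} {φ : ℝ → ℝ}
    (hφ : LipschitzOnWith L φ (Set.Ici 0)) (π : ℕ → ℕ) (F : Finset ℕ) {a x : ℕ → ℝ}
    (hx : ∀ n ∉ F, x n = 0) {B : ℝ} (hB : ∀ n, |a n * x n| ^ p ≤ B * |x n| ^ p) (n : ℕ) :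
    |KPchunk p φ π (fun m => a m * x m) n - a n * KPchunk p φ π x n| ≤
      L / 2 * (|a n * x n| * |Real.log ((∑ m ∈ F with π m = π n, |a m * x m| ^ p) /
          (B * ∑ m ∈ F with π m = π n, |x m| ^ p))|) +
      L / 2 * (|a n * x n| * |Real.log ((∑ m ∈ F, |a m * x m| ^ p) /
          (B * ∑ m ∈ F, |x m| ^ p))|) := by
  by_cases hax : a n * x n = 0
  · have h0 : KPchunk p φ π (fun m => a m * x m) n - a n * KPchunk p φ π x n = 0 := by
      rcases mul_eq_zero.1 hax with h | h <;> simp [KPchunk, h]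
    rw [h0, abs_zero]
    positivity
  have hxn : x n ≠ 0 := right_ne_zero_of_mul hax
  have hBpos : 0 < B := by
    have h : 0 < B * |x n| ^ p := lt_of_lt_of_le (by positivity) (hB n)
    exact pos_of_mul_pos_left h (by positivity)
  obtain ⟨hT1, hT2, hT⟩ := KPchunk_apply_of_ne_zero hp φ π F (y := fun m => a m * x m)
    (fun m hm => by simp [hx m hm]) hax
  obtain ⟨hS1, hS2, hS⟩ := KPchunk_apply_of_ne_zero hp φ π F hx hxn
  rw [hT, hS]
  have hT3 := hT1.trans_le hT2
  have hS3 := hS1.trans_le hS2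
  rw [Real.log_div hT1.ne' (by positivity), Real.log_div hT3.ne' (by positivity),
    Real.log_mul hBpos.ne' hS1.ne', Real.log_mul hBpos.ne' hS3.ne']
  have hlogT := Real.log_le_log hT1 hT2
  have hlogS := Real.log_le_log hS1 hS2
  beta_reduce at hlogT ⊢
  generalize Real.log (∑ m ∈ F, |a m * x m| ^ p) = t at *
  generalize Real.log (∑ m ∈ F with π m = π n, |a m * x m| ^ p) = t' at *
  generalize Real.log (∑ m ∈ F, |x m| ^ p) = s at *
  generalize Real.log (∑ m ∈ F with π m = π n, |x m| ^ p) = s' at *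
  generalize Real.log B = b at *
  have hlip := hφ.dist_le_mul ((t - t') / 2) (Set.mem_Ici.2 (by linarith))
    ((s - s') / 2) (Set.mem_Ici.2 (by linarith))
  rw [Real.dist_eq, Real.dist_eq] at hlip
  have habs : |(t - t') / 2 - (s - s') / 2| ≤ (|t' - (b + s')| + |t - (b + s)|) / 2 := by
    have h := abs_sub (t - (b + s)) (t' - (b + s'))
    rw [show (t - t') / 2 - (s - s') / 2 = (t - (b + s) - (t' - (b + s'))) / 2 by ring,
      abs_div, abs_two]
    linarith
  calc |a n * x n * φ ((t - t') / 2) - a n * (x n * φ ((s - s') / 2))|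
      = |a n * x n| * |φ ((t - t') / 2) - φ ((s - s') / 2)| := by
        rw [← abs_mul]; congr 1; ring
    _ ≤ |a n * x n| * (L * ((|t' - (b + s')| + |t - (b + s)|) / 2)) := by
        gcongr
        exact hlip.trans (by gcongr)
    _ = _ := by ring

open Finset in
/-- Taking `p`-th roots in a weighted estimate for `|y| * |r|`. -/
lemma sum_mul_rpow_root_le {p c M : ℝ} (hp : 0 < p) (hc : 0 ≤ c) (hM : 0 ≤ M) (F : Finset ℕ)
    {y r w : ℕ → ℝ} (hw : ∀ n, 0 ≤ w n)
    (h : ∑ n ∈ F, |y n| ^ p * |r n| ^ p ≤ p ^ p * (M ^ p * ∑ n ∈ F, w n)) :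
    (∑ n ∈ F, (c * (|y n| * |r n|)) ^ p) ^ (1 / p) ≤
      c * p * M * (∑ n ∈ F, w n) ^ (1 / p) := by
  have hW : 0 ≤ ∑ n ∈ F, w n := sum_nonneg fun n _ => hw n
  have hroot : c * p * M * (∑ n ∈ F, w n) ^ (1 / p) =
      (c ^ p * (p ^ p * (M ^ p * ∑ n ∈ F, w n))) ^ (1 / p) := by
    rw [Real.mul_rpow (by positivity) (by positivity),
      Real.mul_rpow (by positivity) (by positivity), Real.mul_rpow (by positivity) hW,
      one_div, Real.rpow_rpow_inv hc hp.ne', Real.rpow_rpow_inv hp.le hp.ne',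
      Real.rpow_rpow_inv hM hp.ne']
    ring
  rw [hroot]
  refine Real.rpow_le_rpow (sum_nonneg fun n _ => by positivity) ?_ (by positivity)
  calc ∑ n ∈ F, (c * (|y n| * |r n|)) ^ p = c ^ p * ∑ n ∈ F, |y n| ^ p * |r n| ^ p := by
        rw [mul_sum]
        refine sum_congr rfl fun n _ => ?_
        rw [Real.mul_rpow hc (by positivity), Real.mul_rpow (by positivity) (by positivity)]
    _ ≤ _ := by gcongr

/-- For `1 ≤ p < ∞`, `φ : [0,∞) → ℝ` Lipschitz (constant `L`) with
`φ 0 = 0`, and any partition `(A_i)` of `ℕ`, the chunked Kalton–Peck map `Ω̃^φ_p` is a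
centralizer: there is a constant `C` depending only on `p` and `L` such that
`‖Ω̃^φ_p(a·x) − a·Ω̃^φ_p(x)‖_p ≤ C‖a‖_∞‖x‖_p` for all bounded `a : ℕ → ℝ` and `x ∈ c00`. -/
theorem chunkedKaltonPeck_centralizer (p : ℝ) (hp : 1 ≤ p) (L : NNReal) :
    ∃ C : ℝ,
      ∀ φ : ℝ → ℝ, LipschitzOnWith L φ (Set.Ici 0) → φ 0 = 0 →
        ∀ π : ℕ → ℕ,
          ∀ (a x : ℕ → ℝ), FinSupp x → ∀ M : ℝ, (∀ n, |a n| ≤ M) →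
            pNorm p (fun n => KPchunk p φ π (fun m => a m * x m) n - a n * KPchunk p φ π x n)
              ≤ C * M * pNorm p x := by
  refine ⟨L * p, fun φ hφ _ π a x hx M ha => ?_⟩
  have hp0 : 0 < p := by linarith
  have hM : 0 ≤ M := (abs_nonneg _).trans (ha 0)
  obtain ⟨F, hF⟩ : ∃ F : Finset ℕ, ∀ n ∉ F, x n = 0 :=
    ⟨hx.toFinset, fun n hn =>
      Function.notMem_support.1 fun h => hn ((Set.Finite.mem_toFinset hx).2 h)⟩
  have hB : ∀ n, |a n * x n| ^ p ≤ M ^ p * |x n| ^ p := fun n => by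
    rw [abs_mul, Real.mul_rpow (abs_nonneg _) (abs_nonneg _)]
    gcongr
    exact ha n
  have hlocal := sum_mul_abs_log_fiber_rpow_le hp0 F π (v := fun n => |a n * x n| ^ p)
    (w := fun n => |x n| ^ p) (fun n => by positivity) hB
  have hglobal := sum_mul_abs_log_fiber_rpow_le hp0 F (fun _ => 0)
    (v := fun n => |a n * x n| ^ p) (w := fun n => |x n| ^ p) (fun n => by positivity) hB
  simp only [Finset.filter_true] at hglobal
  have hlocal' := sum_mul_rpow_root_le (c := L / 2) hp0 (by positivity) hM F
    (fun n => by positivity) hlocal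
  have hglobal' := sum_mul_rpow_root_le (c := L / 2) hp0 (by positivity) hM F
    (fun n => by positivity) hglobal
  rw [pNorm_eq_sum hp0 F hF, pNorm_eq_sum hp0 F fun n hn => by simp [KPchunk, hF n hn]]
  have hmono := Real.rpow_le_rpow (Finset.sum_nonneg fun n _ => by positivity)
    (Finset.sum_le_sum fun n (_ : n ∈ F) => Real.rpow_le_rpow (abs_nonneg _)
      (abs_KPchunk_mul_sub_le hp0 hφ π F hF hB n) hp0.le) (one_div_nonneg.2 hp0.le)
  refine hmono.trans ((Real.Lp_add_le_of_nonneg F hp (fun n _ => by positivity)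
    (fun n _ => by positivity)).trans ((add_le_add hlocal' hglobal').trans_eq ?_))
  ring
end

section
/- Let X₀, E₀ be real normed spaces and Y a real normed space. Let Ψ : X₀ → E₀ and Φ : E₀ → Y be homogeneous quasilinear maps, and define the functional ‖(e,x)‖_Ψ = ‖e − Ψ(x)‖ + ‖x‖ on E₀ × X₀. Then the following are equivalent: (a) there is a homogeneous map Γ : E₀ × X₀ → Y with Γ(e,0) = Φ(e) for every e ∈ E₀ and a constant Q such that ‖Γ(w+w') − Γ(w) − Γ(w')‖ ≤ Q(‖w‖_Ψ + ‖w'‖_Ψ) for all w, w' ∈ E₀ × X₀; (b) there is a homogeneous map H : X₀ → Y and a constant K such that ‖H(x+x') − H(x) − H(x') − Φ(Ψ(x+x') − Ψ(x) − Ψ(x'))‖ ≤ K(‖x‖ + ‖x'‖) for all x, x' ∈ X₀. -/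
/-- Let `X₀, E₀, Y` be real normed spaces, `Ψ : X₀ → E₀` and
`Φ : E₀ → Y` homogeneous quasilinear maps, and put `‖(e,x)‖_Ψ = ‖e − Ψ(x)‖ + ‖x‖` on
`E₀ × X₀`. Then `Φ` admits a homogeneous quasilinear (w.r.t. `‖·‖_Ψ`) extension
`Γ : E₀ × X₀ → Y` with `Γ(e,0) = Φ(e)` if and only if there is a homogeneous map
`H : X₀ → Y` and a constant `K` with
`‖H(x+x') − H(x) − H(x') − Φ(Ψ(x+x') − Ψ(x) − Ψ(x'))‖ ≤ K(‖x‖ + ‖x'‖)` for all `x, x'`. -/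
theorem extension_iff_witness
    (X₀ E₀ Y : Type*)
    [NormedAddCommGroup X₀] [NormedSpace ℝ X₀]
    [NormedAddCommGroup E₀] [NormedSpace ℝ E₀]
    [NormedAddCommGroup Y] [NormedSpace ℝ Y]
    (Ψ : X₀ → E₀) (Φ : E₀ → Y)
    (hΨ_homog : ∀ (c : ℝ) (x : X₀), Ψ (c • x) = c • Ψ x)
    (hΦ_homog : ∀ (c : ℝ) (e : E₀), Φ (c • e) = c • Φ e)
    (QΨ : ℝ) (hΨ_quasi : ∀ x x' : X₀, ‖Ψ (x + x') - Ψ x - Ψ x'‖ ≤ QΨ * (‖x‖ + ‖x'‖))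
    (QΦ : ℝ) (hΦ_quasi : ∀ e e' : E₀, ‖Φ (e + e') - Φ e - Φ e'‖ ≤ QΦ * (‖e‖ + ‖e'‖)) :
    (∃ Γ : E₀ × X₀ → Y,
      (∀ (c : ℝ) (w : E₀ × X₀), Γ (c • w) = c • Γ w) ∧
      (∀ e : E₀, Γ (e, 0) = Φ e) ∧
      (∃ Q : ℝ, ∀ w w' : E₀ × X₀,
        ‖Γ (w + w') - Γ w - Γ w'‖
          ≤ Q * ((‖w.1 - Ψ w.2‖ + ‖w.2‖) + (‖w'.1 - Ψ w'.2‖ + ‖w'.2‖))))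
    ↔
    (∃ H : X₀ → Y,
      (∀ (c : ℝ) (x : X₀), H (c • x) = c • H x) ∧
      (∃ K : ℝ, ∀ x x' : X₀,
        ‖H (x + x') - H x - H x' - Φ (Ψ (x + x') - Ψ x - Ψ x')‖ ≤ K * (‖x‖ + ‖x'‖))) := by
  have hΨ_abs (x x' : X₀) : ‖Ψ (x + x') - Ψ x - Ψ x'‖ ≤ |QΨ| * (‖x‖ + ‖x'‖) :=
    (hΨ_quasi x x').trans (mul_le_mul_of_nonneg_right (le_abs_self QΨ) (by positivity))
  have hΦ_abs (e e' : E₀) : ‖Φ (e + e') - Φ e - Φ e'‖ ≤ |QΦ| * (‖e‖ + ‖e'‖) :=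
    (hΦ_quasi e e').trans (mul_le_mul_of_nonneg_right (le_abs_self QΦ) (by positivity))
  have hΨ_zero : Ψ 0 = 0 := by simpa using hΨ_homog 0 0
  constructor
  · rintro ⟨Γ, hΓ_homog, hΓ_ext, Q, hΓ⟩
    refine ⟨fun x => Γ (Ψ x, x), fun c x => ?_, 2 * |Q| * (1 + |QΨ|), fun x x' => ?_⟩
    · simp only [hΨ_homog, ← hΓ_homog, Prod.smul_mk]
    have hΓ_abs (w w' : E₀ × X₀) : ‖Γ (w + w') - Γ w - Γ w'‖
        ≤ |Q| * ((‖w.1 - Ψ w.2‖ + ‖w.2‖) + (‖w'.1 - Ψ w'.2‖ + ‖w'.2‖)) :=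
      (hΓ w w').trans (mul_le_mul_of_nonneg_right (le_abs_self Q) (by positivity))
    set d := Ψ (x + x') - Ψ x - Ψ x' with hd
    have hd_le : ‖d‖ ≤ |QΨ| * (‖x‖ + ‖x'‖) := hΨ_abs x x'
    have h_sum := hΓ_abs (Ψ x, x) (Ψ x', x')
    have h_shift := hΓ_abs (Ψ x + Ψ x', x + x') (d, 0)
    have h_add : (Ψ x + Ψ x', x + x') + (d, 0) = (Ψ (x + x'), x + x') := by
      ext <;> simp [hd]
    have h_norm : ‖Ψ x + Ψ x' - Ψ (x + x')‖ = ‖d‖ := by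
      rw [← norm_neg d, hd]
      congr 1
      abel
    simp only [h_add, h_norm, hΓ_ext, hΨ_zero, sub_zero, norm_zero, add_zero] at h_shift
    simp only [Prod.mk_add_mk, sub_self, norm_zero, zero_add] at h_sum
    calc _ = ‖(Γ (Ψ (x + x'), x + x') - Γ (Ψ x + Ψ x', x + x') - Φ d)
            + (Γ (Ψ x + Ψ x', x + x') - Γ (Ψ x, x) - Γ (Ψ x', x'))‖ := by
          congr 1
          abel
      _ ≤ |Q| * (‖d‖ + ‖x + x'‖ + ‖d‖) + |Q| * (‖x‖ + ‖x'‖) :=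
          norm_add_le_of_le h_shift h_sum
      _ ≤ |Q| * (|QΨ| * (‖x‖ + ‖x'‖) + (‖x‖ + ‖x'‖) + |QΨ| * (‖x‖ + ‖x'‖))
            + |Q| * (‖x‖ + ‖x'‖) := by
          gcongr
          exact norm_add_le x x'
      _ = _ := by ring
  · rintro ⟨H, hH_homog, K, hH⟩
    have hH_zero : H 0 = 0 := by simpa using hH_homog 0 0
    refine ⟨fun w => H w.2 + Φ (w.1 - Ψ w.2), fun c w => ?_, fun e => ?_,
      |K| + |QΦ| * |QΨ| + 2 * |QΦ|, ?_⟩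
    · simp only [Prod.smul_fst, Prod.smul_snd, hΨ_homog, hH_homog, ← smul_sub, hΦ_homog,
        smul_add]
    · simp [hH_zero, hΨ_zero]
    rintro ⟨e, x⟩ ⟨e', x'⟩
    simp only [Prod.mk_add_mk]
    have h_wit : ‖H (x + x') - H x - H x' - Φ (Ψ (x + x') - Ψ x - Ψ x')‖
        ≤ |K| * (‖x‖ + ‖x'‖) :=
      (hH x x').trans (mul_le_mul_of_nonneg_right (le_abs_self K) (by positivity))
    have hd_le := hΨ_abs x x'
    have h_sub : e + e' - Ψ (x + x')
        = (e - Ψ x) + (e' - Ψ x') - (Ψ (x + x') - Ψ x - Ψ x') := by abel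
    rw [h_sub]
    generalize Ψ (x + x') - Ψ x - Ψ x' = d at *
    generalize e - Ψ x = a
    generalize e' - Ψ x' = a'
    have h_sum := hΦ_abs a a'
    have h_neg := hΦ_abs (a + a') (-d)
    have hΦ_neg : Φ (-d) = -Φ d := by simpa using hΦ_homog (-1) d
    rw [hΦ_neg, norm_neg, ← sub_eq_add_neg] at h_neg
    calc _ = ‖(H (x + x') - H x - H x' - Φ d) + (Φ (a + a' - d) - Φ (a + a') - -Φ d)
            + (Φ (a + a') - Φ a - Φ a')‖ := by
          congr 1
          abel
      _ ≤ |K| * (‖x‖ + ‖x'‖) + |QΦ| * (‖a + a'‖ + ‖d‖) + |QΦ| * (‖a‖ + ‖a'‖) :=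
          norm_add_le_of_le (norm_add_le_of_le h_wit h_neg) h_sum
      _ ≤ |K| * (‖x‖ + ‖x'‖) + |QΦ| * ((‖a‖ + ‖a'‖) + |QΨ| * (‖x‖ + ‖x'‖))
            + |QΦ| * (‖a‖ + ‖a'‖) := by
          gcongr
          exact norm_add_le a a'
      _ ≤ (|K| + |QΦ| * |QΨ| + 2 * |QΦ|) * (‖x‖ + ‖x'‖)
            + (|K| + |QΦ| * |QΨ| + 2 * |QΦ|) * (‖a‖ + ‖a'‖) := by
          have : 0 ≤ 2 * |QΦ| * (‖x‖ + ‖x'‖) := by positivity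
          have : 0 ≤ (|K| + |QΦ| * |QΨ|) * (‖a‖ + ‖a'‖) := by positivity
          linarith
      _ = _ := by ring
end

section
/- Let k ≥ 1, let S ⊆ ℕ be a finite set with |S| = 2^k, and let I, J : 𝒯_k → P(S) be adequate partitions of S with associated vectors x_α = Σ_{i∈I(α)} e_i and y_α = Σ_{i∈J(α)} e_i. Let Φ, H : c00 → ℓ₂ be homogeneous support-preserving maps and K a constant such that whenever x, y ∈ c00 have disjoint supports and ‖x‖₂ = ‖y‖₂ one has ‖H(x+y) − H(x) − H(y) − Φ(x+y)‖₂ ≤ K‖x‖₂. Then for every j with 1 ≤ j ≤ k: ‖Σ_{|α|=j}(H(x_α) − H(y_α)) + Σ_{|α|<j}(Φ(x_α) − Φ(y_α))‖₂ ≤ 2Kj√(2^{k−1}). -/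
/-- The `ℓ₂` norm of a sequence, `‖x‖₂ = (∑ₙ |x n|²)^{1/2}`. -/
noncomputable def l2Norm (x : ℕ → ℝ) : ℝ := Real.sqrt (∑' n, (x n) ^ 2)

/-- The indicator vector `1_A = Σ_{i∈A} e_i` of a finite set `A ⊆ ℕ`. -/
noncomputable def indVec (A : Finset ℕ) : ℕ → ℝ := fun n => if n ∈ A then 1 else 0

/-- An adequate partition of a finite set `S` of cardinality `2^k`: a map `I` from the
dyadic tree `𝒯_k` (words over `{0,1}` of length at most `k`, here `List Bool`, with
`α0 = α ++ [false]`, `α1 = α ++ [true]`) to subsets of `S` such that `I(∅) = S`, each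
`I(α)` is nonempty, and for `|α| < k`, `I(α)` is the disjoint union of `I(α0)` and
`I(α1)`. -/
def Adequate (k : ℕ) (S : Finset ℕ) (I : List Bool → Finset ℕ) : Prop :=
  I [] = S ∧
  (∀ α : List Bool, α.length ≤ k → (I α).Nonempty) ∧
  (∀ α : List Bool, α.length < k →
    Disjoint (I (α ++ [false])) (I (α ++ [true])) ∧
    I α = I (α ++ [false]) ∪ I (α ++ [true]))

lemma l2Norm_eq_norm {S : Finset ℕ} {f : ℕ → ℝ} (hf : ∀ n ∉ S, f n = 0) :
    l2Norm f = ‖(WithLp.toLp 2 (fun n : S => f n) : EuclideanSpace ℝ S)‖ := by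
  rw [l2Norm, EuclideanSpace.norm_eq, tsum_eq_sum (s := S) (fun n hn => by simp [hf n hn])]
  simp only [Real.norm_eq_abs, sq_abs]
  rw [Finset.sum_coe_sort S (fun n => f n ^ 2)]

lemma l2Norm_sum_sub_le {ι : Type*} {S : Finset ℕ} (s : Finset ι) (f g : ι → ℕ → ℝ)
    (hf : ∀ i ∈ s, ∀ n ∉ S, f i n = 0) (hg : ∀ i ∈ s, ∀ n ∉ S, g i n = 0) :
    l2Norm (fun n => ∑ i ∈ s, (f i n - g i n)) ≤ ∑ i ∈ s, (l2Norm (f i) + l2Norm (g i)) := by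
  rw [l2Norm_eq_norm (S := S)
    (fun n hn => Finset.sum_eq_zero fun i hi => by rw [hf i hi n hn, hg i hi n hn, sub_zero])]
  have key : (WithLp.toLp 2 (fun n : S => ∑ i ∈ s, (f i n - g i n)) : EuclideanSpace ℝ S) =
      ∑ i ∈ s, ((WithLp.toLp 2 (fun n : S => f i n) : EuclideanSpace ℝ S) -
        WithLp.toLp 2 (fun n : S => g i n)) := by
    ext n
    simp
  rw [key]
  refine (norm_sum_le _ _).trans (Finset.sum_le_sum fun i hi => ?_)
  rw [l2Norm_eq_norm (hf i hi), l2Norm_eq_norm (hg i hi)]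
  exact norm_sub_le _ _

lemma l2Norm_nonneg (f : ℕ → ℝ) : 0 ≤ l2Norm f := Real.sqrt_nonneg _

lemma l2Norm_sq (f : ℕ → ℝ) : l2Norm f ^ 2 = ∑' n, f n ^ 2 :=
  Real.sq_sqrt (tsum_nonneg fun _ => sq_nonneg _)

lemma l2Norm_sum_sq {ι : Type*} [Fintype ι] (g : ι → ℕ → ℝ)
    (hg : ∀ v, Summable fun n => g v n ^ 2)
    (hdisj : ∀ v w, v ≠ w → ∀ n, g v n = 0 ∨ g w n = 0) :
    l2Norm (fun n => ∑ v, g v n) ^ 2 = ∑ v, l2Norm (g v) ^ 2 := by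
  have key : ∀ n, (∑ v, g v n) ^ 2 = ∑ v, g v n ^ 2 := fun n => by
    rw [sq, Finset.sum_mul_sum]
    refine Finset.sum_congr rfl fun v _ => ?_
    rw [Finset.sum_eq_single v (fun w _ hw => ?_) (by simp), sq]
    rcases hdisj v w hw.symm n with h | h <;> simp [h]
  simp only [l2Norm_sq, key]
  exact Summable.tsum_finsetSum fun v _ => hg v

lemma l2Norm_indVec (A : Finset ℕ) : l2Norm (indVec A) = Real.sqrt A.card := by
  rw [l2Norm, tsum_eq_sum (s := A) (fun n hn => by simp [indVec, hn])]
  congr 1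
  rw [Finset.sum_congr rfl (g := fun _ => (1 : ℝ)) (fun n hn => by simp [indVec, hn])]
  simp

lemma finSupp_indVec (A : Finset ℕ) : FinSupp (indVec A) :=
  A.finite_toSet.subset fun n hn => by
    by_contra h
    exact hn (if_neg h)

lemma indVec_union {A B : Finset ℕ} (h : Disjoint A B) :
    indVec (A ∪ B) = indVec A + indVec B := by
  ext n
  by_cases hA : n ∈ A
  · simp [indVec, hA, Finset.disjoint_left.mp h hA]
  · simp [indVec, hA]

/-- The sum of `F` over the words of length `i`. -/
def levelSum {M : Type*} [AddCommMonoid M] (F : List Bool → M) (i : ℕ) : M :=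
  ∑ v : Fin i → Bool, F (List.ofFn v)

lemma levelSum_succ {M : Type*} [AddCommMonoid M] (F : List Bool → M) (i : ℕ) :
    levelSum F (i + 1) = levelSum (fun α => F (α ++ [false]) + F (α ++ [true])) i := by
  unfold levelSum
  rw [← (Fin.snocEquiv (fun _ : Fin (i + 1) => Bool)).sum_comp, Fintype.sum_prod_type_right]
  refine Finset.sum_congr rfl fun v _ => ?_
  simp [List.ofFn_succ', Fin.snocEquiv, add_comm, -List.ofFn_succ]

lemma levelSum_eq_of_additive {M : Type*} [AddCommMonoid M] {F : List Bool → M} {k : ℕ}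
    (hF : ∀ α : List Bool, α.length < k → F α = F (α ++ [false]) + F (α ++ [true]))
    {i : ℕ} (hi : i ≤ k) : levelSum F i = F [] := by
  induction i with
  | zero => simp [levelSum]
  | succ i ih =>
    rw [levelSum_succ, ← ih (by omega)]
    exact Finset.sum_congr rfl fun v _ => (hF _ (by simpa using hi)).symm

lemma levelSum_telescope {M : Type*} [AddCommGroup M] (h p : List Bool → M) (j : ℕ) :
    levelSum h j + ∑ i ∈ Finset.range j, levelSum p i =
      h [] - ∑ i ∈ Finset.range j,
        levelSum (fun α => h α - h (α ++ [false]) - h (α ++ [true]) - p α) i := by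
  induction j with
  | zero => simp [levelSum]
  | succ j ih =>
    rw [Finset.sum_range_succ, Finset.sum_range_succ, levelSum_succ]
    have : levelSum (fun α => h α - h (α ++ [false]) - h (α ++ [true]) - p α) j =
        levelSum h j - levelSum (fun α => h (α ++ [false]) + h (α ++ [true])) j
          - levelSum p j := by
      simp only [levelSum, ← Finset.sum_sub_distrib, sub_sub, add_assoc]
    rw [this, sub_add_eq_sub_sub, ← ih]
    abel

namespace Adequate

variable {k : ℕ} {S : Finset ℕ} {I : List Bool → Finset ℕ}

lemma card_eq_add (hI : Adequate k S I) {α : List Bool} (hα : α.length < k) :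
    (I α).card = (I (α ++ [false])).card + (I (α ++ [true])).card := by
  obtain ⟨hd, hu⟩ := hI.2.2 α hα
  rw [hu, Finset.card_union_of_disjoint hd]

lemma two_pow_le_card (hI : Adequate k S I) (d : ℕ) :
    ∀ α : List Bool, α.length + d = k → 2 ^ d ≤ (I α).card := by
  induction d with
  | zero => exact fun α hα => (hI.2.1 α (by omega)).card_pos
  | succ d ih =>
    intro α hα
    rw [hI.card_eq_add (by omega), pow_succ, mul_two]
    exact add_le_add (ih _ (by simp; omega)) (ih _ (by simp; omega))

lemma card_eq (hI : Adequate k S I) (hS : S.card = 2 ^ k) {α : List Bool}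
    (hα : α.length ≤ k) : (I α).card = 2 ^ (k - α.length) := by
  have hsum : levelSum (fun β => (I β).card) α.length = 2 ^ k := by
    rw [levelSum_eq_of_additive (fun β hβ => hI.card_eq_add hβ) hα, hI.1, hS]
  have hle : ∀ v ∈ (Finset.univ : Finset (Fin α.length → Bool)),
      2 ^ (k - α.length) ≤ (I (List.ofFn v)).card :=
    fun v _ => hI.two_pow_le_card _ _ (by simp; omega)
  have heq := (Finset.sum_eq_sum_iff_of_le hle).mp (by
    rw [show ∑ v, (I (List.ofFn v)).card = 2 ^ k from hsum]
    simp [← pow_add, Nat.add_sub_cancel' hα]) α.get (Finset.mem_univ _)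
  rw [List.ofFn_get] at heq
  exact heq.symm

lemma subset (hI : Adequate k S I) {α : List Bool} (hα : α.length ≤ k) : I α ⊆ S := by
  induction α using List.reverseRecOn with
  | nil => exact hI.1.subset
  | append_singleton α b ih =>
    rw [List.length_append, List.length_singleton] at hα
    refine Finset.Subset.trans ?_ (ih (by omega))
    rw [(hI.2.2 α (by omega)).2]
    cases b
    · exact Finset.subset_union_left
    · exact Finset.subset_union_right

lemma eq_of_mem (hI : Adequate k S I) {i : ℕ} (hi : i ≤ k) {v w : Fin i → Bool} {n : ℕ}
    (hv : n ∈ I (List.ofFn v)) (hw : n ∈ I (List.ofFn w)) : v = w := by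
  have hsum := levelSum_eq_of_additive (F := fun α => if n ∈ I α then 1 else 0) (k := k)
    (fun α hα => by
      obtain ⟨hd, hu⟩ := hI.2.2 α hα
      by_cases h : n ∈ I (α ++ [false])
      · simp [hu, h, Finset.disjoint_left.mp hd h]
      · simp [hu, h]) hi
  have hcard : (Finset.univ.filter fun v : Fin i → Bool => n ∈ I (List.ofFn v)).card ≤ 1 := by
    rw [Finset.card_filter]
    refine hsum.le.trans ?_
    split_ifs <;> simp
  exact Finset.card_le_one.mp hcard v (by simpa using hv) w (by simpa using hw)

end Adequate

/-- The defect of `H` from being additive, up to `Φ`, at the node `α` of the tree `I`. -/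
noncomputable def treeDefect (Φ H : (ℕ → ℝ) → (ℕ → ℝ)) (I : List Bool → Finset ℕ)
    (α : List Bool) : ℕ → ℝ :=
  H (indVec (I α)) - H (indVec (I (α ++ [false]))) - H (indVec (I (α ++ [true])))
    - Φ (indVec (I α))

section Defect

variable {k : ℕ} {S : Finset ℕ} {I : List Bool → Finset ℕ} {Φ H : (ℕ → ℝ) → (ℕ → ℝ)}

lemma treeDefect_eq_zero (hI : Adequate k S I)
    (hΦ_supp : ∀ x : ℕ → ℝ, FinSupp x → ∀ n, x n = 0 → Φ x n = 0)
    (hH_supp : ∀ x : ℕ → ℝ, FinSupp x → ∀ n, x n = 0 → H x n = 0)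
    {α : List Bool} (hα : α.length < k) {n : ℕ} (hn : n ∉ I α) :
    treeDefect Φ H I α n = 0 := by
  have hn' := hn
  rw [(hI.2.2 α hα).2, Finset.mem_union, not_or] at hn'
  simp [treeDefect, hH_supp _ (finSupp_indVec _) n (if_neg hn),
    hH_supp _ (finSupp_indVec _) n (if_neg hn'.1), hH_supp _ (finSupp_indVec _) n (if_neg hn'.2),
    hΦ_supp _ (finSupp_indVec _) n (if_neg hn)]

lemma l2Norm_treeDefect_le (hI : Adequate k S I) (hS : S.card = 2 ^ k) {K : ℝ}
    (hK : ∀ x y : ℕ → ℝ, FinSupp x → FinSupp y →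
      (∀ n, x n = 0 ∨ y n = 0) → l2Norm x = l2Norm y →
      l2Norm (fun n => H (x + y) n - H x n - H y n - Φ (x + y) n) ≤ K * l2Norm x)
    {α : List Bool} (hα : α.length < k) :
    l2Norm (treeDefect Φ H I α) ≤ K * Real.sqrt (2 ^ (k - (α.length + 1))) := by
  obtain ⟨hd, hu⟩ := hI.2.2 α hα
  have hnorm : ∀ b, l2Norm (indVec (I (α ++ [b]))) = Real.sqrt (2 ^ (k - (α.length + 1))) :=
    fun b => by
      rw [l2Norm_indVec, hI.card_eq hS (by simpa using hα)]
      simp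
  have h := hK _ _ (finSupp_indVec (I (α ++ [false]))) (finSupp_indVec (I (α ++ [true])))
    (fun n => by
      by_cases h : n ∈ I (α ++ [false])
      · exact Or.inr (if_neg (Finset.disjoint_left.mp hd h))
      · exact Or.inl (if_neg h))
    ((hnorm _).trans (hnorm _).symm)
  rw [← indVec_union hd, ← hu, hnorm] at h
  exact h

lemma levelSum_treeDefect_eq_zero (hI : Adequate k S I)
    (hΦ_supp : ∀ x : ℕ → ℝ, FinSupp x → ∀ n, x n = 0 → Φ x n = 0)
    (hH_supp : ∀ x : ℕ → ℝ, FinSupp x → ∀ n, x n = 0 → H x n = 0)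
    {i : ℕ} (hi : i < k) {n : ℕ} (hn : n ∉ S) :
    levelSum (treeDefect Φ H I) i n = 0 := by
  rw [levelSum, Finset.sum_apply]
  exact Finset.sum_eq_zero fun v _ => treeDefect_eq_zero hI hΦ_supp hH_supp (by simpa using hi)
    fun h => hn (hI.subset (by simpa using hi.le) h)

lemma l2Norm_levelSum_treeDefect_le (hI : Adequate k S I) (hS : S.card = 2 ^ k)
    (hΦ_supp : ∀ x : ℕ → ℝ, FinSupp x → ∀ n, x n = 0 → Φ x n = 0)
    (hH_supp : ∀ x : ℕ → ℝ, FinSupp x → ∀ n, x n = 0 → H x n = 0) {K : ℝ}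
    (hK : ∀ x y : ℕ → ℝ, FinSupp x → FinSupp y →
      (∀ n, x n = 0 ∨ y n = 0) → l2Norm x = l2Norm y →
      l2Norm (fun n => H (x + y) n - H x n - H y n - Φ (x + y) n) ≤ K * l2Norm x)
    {i : ℕ} (hi : i < k) :
    l2Norm (levelSum (treeDefect Φ H I) i) ≤ K * Real.sqrt (2 ^ (k - 1)) := by
  have hlen : ∀ v : Fin i → Bool, (List.ofFn v).length < k := fun v => by simpa using hi
  have hK0 : 0 ≤ K := by
    have h := (l2Norm_nonneg _).trans
      (l2Norm_treeDefect_le hI hS hK (hlen fun _ => false))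
    exact nonneg_of_mul_nonneg_left h (by positivity)
  have hzero : ∀ (v : Fin i → Bool) (n : ℕ), n ∉ I (List.ofFn v) →
      treeDefect Φ H I (List.ofFn v) n = 0 :=
    fun v n => treeDefect_eq_zero hI hΦ_supp hH_supp (hlen v)
  have hsq : l2Norm (levelSum (treeDefect Φ H I) i) ^ 2 =
      ∑ v : Fin i → Bool, l2Norm (treeDefect Φ H I (List.ofFn v)) ^ 2 := by
    rw [← l2Norm_sum_sq]
    · congr 2
      ext n
      simp [levelSum]
    · exact fun v => summable_of_ne_finset_zero (s := I (List.ofFn v))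
        fun n hn => by simp [hzero v n hn]
    · intro v w hvw n
      by_contra! h
      exact hvw (hI.eq_of_mem hi.le (not_imp_comm.mp (hzero v n) h.1)
        (not_imp_comm.mp (hzero w n) h.2))
  refine le_of_sq_le_sq ?_ (by positivity)
  rw [hsq]
  refine (Finset.sum_le_sum (g := fun _ => (K * Real.sqrt (2 ^ (k - (i + 1)))) ^ 2)
    fun v _ => pow_le_pow_left₀ (l2Norm_nonneg _) ?_ 2).trans_eq ?_
  · simpa using l2Norm_treeDefect_le hI hS hK (hlen v)
  · simp only [mul_pow, Real.sq_sqrt (pow_nonneg zero_le_two _ : (0 : ℝ) ≤ 2 ^ _),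
      Finset.sum_const, Finset.card_univ, Fintype.card_fun, Fintype.card_bool, Fintype.card_fin,
      nsmul_eq_mul]
    rw [show k - 1 = i + (k - (i + 1)) by omega, pow_add]
    push_cast
    ring

end Defect

/-- Let `|S| = 2^k`, let `I, J` be adequate partitions of `S` with
associated vectors `x_α = 1_{I(α)}`, `y_α = 1_{J(α)}`. Let `Φ, H : c00 → ℓ₂` be
homogeneous support-preserving maps and `K` a constant such that
`‖H(x+y) − H(x) − H(y) − Φ(x+y)‖₂ ≤ K‖x‖₂` whenever `x, y ∈ c00` are disjointly
supported with `‖x‖₂ = ‖y‖₂`. Then for `1 ≤ j ≤ k`,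
`‖Σ_{|α|=j}(H(x_α) − H(y_α)) + Σ_{|α|<j}(Φ(x_α) − Φ(y_α))‖₂ ≤ 2Kj√(2^{k−1})`. -/
theorem tree_estimate
    (k : ℕ) (hk : 1 ≤ k) (S : Finset ℕ) (hS : S.card = 2 ^ k)
    (I J : List Bool → Finset ℕ) (hI : Adequate k S I) (hJ : Adequate k S J)
    (Φ H : (ℕ → ℝ) → (ℕ → ℝ))
    (hΦ_l2 : ∀ x, FinSupp x → Summable (fun n => (Φ x n) ^ 2))
    (hH_l2 : ∀ x, FinSupp x → Summable (fun n => (H x n) ^ 2))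
    (hΦ_homog : ∀ (c : ℝ) (x : ℕ → ℝ), FinSupp x → Φ (c • x) = c • Φ x)
    (hH_homog : ∀ (c : ℝ) (x : ℕ → ℝ), FinSupp x → H (c • x) = c • H x)
    (hΦ_supp : ∀ x : ℕ → ℝ, FinSupp x → ∀ n, x n = 0 → Φ x n = 0)
    (hH_supp : ∀ x : ℕ → ℝ, FinSupp x → ∀ n, x n = 0 → H x n = 0)
    (K : ℝ)
    (hK : ∀ x y : ℕ → ℝ, FinSupp x → FinSupp y →
      (∀ n, x n = 0 ∨ y n = 0) → l2Norm x = l2Norm y →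
      l2Norm (fun n => H (x + y) n - H x n - H y n - Φ (x + y) n) ≤ K * l2Norm x)
    (j : ℕ) (hj1 : 1 ≤ j) (hjk : j ≤ k) :
    l2Norm (fun n =>
        (∑ v : Fin j → Bool,
          (H (indVec (I (List.ofFn v))) n - H (indVec (J (List.ofFn v))) n)) +
        ∑ i ∈ Finset.range j, ∑ v : Fin i → Bool,
          (Φ (indVec (I (List.ofFn v))) n - Φ (indVec (J (List.ofFn v))) n))
      ≤ 2 * K * (j : ℝ) * Real.sqrt ((2 : ℝ) ^ (k - 1)) := by
  have htel : ∀ (L : List Bool → Finset ℕ) (n : ℕ),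
      (∑ v : Fin j → Bool, H (indVec (L (List.ofFn v))) n) +
        ∑ i ∈ Finset.range j, ∑ v : Fin i → Bool, Φ (indVec (L (List.ofFn v))) n =
      H (indVec (L [])) n - ∑ i ∈ Finset.range j, levelSum (treeDefect Φ H L) i n := fun L n => by
    have h := congrFun
      (levelSum_telescope (fun α => H (indVec (L α))) (fun α => Φ (indVec (L α))) j) n
    simpa [levelSum, treeDefect] using h
  have hfun : (fun n =>
      (∑ v : Fin j → Bool,
        (H (indVec (I (List.ofFn v))) n - H (indVec (J (List.ofFn v))) n)) +
      ∑ i ∈ Finset.range j, ∑ v : Fin i → Bool,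
        (Φ (indVec (I (List.ofFn v))) n - Φ (indVec (J (List.ofFn v))) n)) =
      fun n => ∑ i ∈ Finset.range j,
        (levelSum (treeDefect Φ H J) i n - levelSum (treeDefect Φ H I) i n) := by
    ext n
    have h₁ := htel I n
    have h₂ := htel J n
    rw [hI.1] at h₁
    rw [hJ.1] at h₂
    simp only [Finset.sum_sub_distrib]
    linarith
  have hlt : ∀ i ∈ Finset.range j, i < k := fun i hi => (Finset.mem_range.mp hi).trans_le hjk
  rw [hfun]
  calc _ ≤ ∑ i ∈ Finset.range j, (l2Norm (levelSum (treeDefect Φ H J) i) +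
        l2Norm (levelSum (treeDefect Φ H I) i)) :=
      l2Norm_sum_sub_le (S := S) _ _ _
        (fun i hi n hn => levelSum_treeDefect_eq_zero hJ hΦ_supp hH_supp (hlt i hi) hn)
        (fun i hi n hn => levelSum_treeDefect_eq_zero hI hΦ_supp hH_supp (hlt i hi) hn)
    _ ≤ ∑ i ∈ Finset.range j, (K * Real.sqrt (2 ^ (k - 1)) + K * Real.sqrt (2 ^ (k - 1))) :=
      Finset.sum_le_sum fun i hi => add_le_add
        (l2Norm_levelSum_treeDefect_le hJ hS hΦ_supp hH_supp hK (hlt i hi))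
        (l2Norm_levelSum_treeDefect_le hI hS hΦ_supp hH_supp hK (hlt i hi))
    _ = _ := by
      rw [Finset.sum_const, Finset.card_range, nsmul_eq_mul]
      ring
end
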